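/- For n = 5, l = 1.01 and l̃ = 1, the set of positive solutions (x, x̃) of the 5-gonal Siamese system with parameters (l, l̃) has exactly one element, and this element satisfies 0.498 < x < 0.499 and 0.027 < x̃ < 0.028. (Geometrically: there exists a unique pentagonal Siamese dipyramid with faces congruent to Δ(1.01) and Δ(1).) -/

import Mathlib

/-- `(x, x̃) = p` is a positive solution of the `5`-gonal Siamese system with
parameters `(l, l̃)`. -/
def SiamesePosSol5 (l lt : ℝ) (p : ℝ × ℝ) : Prop :=
  0 < p.1 ∧ p.1 < 1 ∧ 0 < p.2 ∧ p.2 < 1 ∧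
  l ≤ 2 * Real.sqrt (1 - p.1 ^ 2) ∧ lt ≤ 2 * Real.sqrt (1 - p.2 ^ 2) ∧
  p.2 = Real.sqrt (1 - p.1 ^ 2) *
      Real.sin (5 * Real.arcsin (l / (2 * Real.sqrt (1 - p.1 ^ 2)))) ∧
  p.1 = Real.sqrt (1 - p.2 ^ 2) *
      Real.sin (5 * Real.arcsin (lt / (2 * Real.sqrt (1 - p.2 ^ 2))))

noncomputable def GG (l x : ℝ) : ℝ :=
  l / 2 * (5 - 5 * (l ^ 2 / (1 - x ^ 2)) + (l ^ 2 / (1 - x ^ 2)) ^ 2)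

theorem sin_five (t : ℝ) : Real.sin (5 * t) =
    16 * Real.sin t ^ 5 - 20 * Real.sin t ^ 3 + 5 * Real.sin t := by
  have h : 5 * t = 2 * t + 3 * t := by ring
  have hc : Real.cos t ^ 2 = 1 - Real.sin t ^ 2 := Real.cos_sq' t
  rw [h, Real.sin_add, Real.sin_two_mul, Real.cos_two_mul, Real.sin_three_mul,
    Real.cos_three_mul]
  have h4 : Real.cos t ^ 4 = (1 - Real.sin t ^ 2) ^ 2 := by rw [← hc]; ring
  ring_nf
  rw [h4, hc]
  ring

theorem key {l x : ℝ} (hl : 0 < l) (hx0 : 0 < x) (hx1 : x < 1)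
    (h : l ≤ 2 * Real.sqrt (1 - x ^ 2)) :
    Real.sqrt (1 - x ^ 2) * Real.sin (5 * Real.arcsin (l / (2 * Real.sqrt (1 - x ^ 2))))
      = GG l x := by
  have hp : 0 < 1 - x ^ 2 := by nlinarith
  have hr : 0 < Real.sqrt (1 - x ^ 2) := Real.sqrt_pos.mpr hp
  have hs : Real.sqrt (1 - x ^ 2) ^ 2 = 1 - x ^ 2 := Real.sq_sqrt hp.le
  have h0 : 0 < l / (2 * Real.sqrt (1 - x ^ 2)) := by positivity
  have h1 : l / (2 * Real.sqrt (1 - x ^ 2)) ≤ 1 := by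
    rw [div_le_one (by positivity)]; exact h
  rw [sin_five, Real.sin_arcsin (by linarith) h1]
  unfold GG
  generalize Real.sqrt (1 - x ^ 2) = r at *
  rw [← hs]
  field_simp
  ring

theorem GG_sub (l a b : ℝ) : GG l a - GG l b =
    l / 2 * ((l ^ 2 / (1 - b ^ 2) - l ^ 2 / (1 - a ^ 2)) *
      (5 - (l ^ 2 / (1 - a ^ 2) + l ^ 2 / (1 - b ^ 2)))) := by
  unfold GG; ring

theorem u_bd {l x : ℝ} (hl : 1 ≤ l) (hl2 : l ≤ 1.01) (hx : 0 ≤ x) (hx2 : x ≤ 1 / 2) :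
    1 ≤ l ^ 2 / (1 - x ^ 2) ∧ l ^ 2 / (1 - x ^ 2) ≤ 2 := by
  have hp : 0 < 1 - x ^ 2 := by nlinarith
  constructor
  · rw [le_div_iff₀ hp]; nlinarith
  · rw [div_le_iff₀ hp]; norm_num at *; nlinarith

theorem u_sub {l a b : ℝ} (ha : 0 ≤ a) (hab : a ≤ b) (hb : b ≤ 1 / 2) :
    l ^ 2 / (1 - b ^ 2) - l ^ 2 / (1 - a ^ 2) =
      l ^ 2 * ((b - a) * (b + a) / ((1 - a ^ 2) * (1 - b ^ 2))) := by
  have hp : 1 - a ^ 2 ≠ 0 := by nlinarith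
  have hq : 1 - b ^ 2 ≠ 0 := by nlinarith
  field_simp
  ring

theorem GG_anti {l a b : ℝ} (hl : 1 ≤ l) (hl2 : l ≤ 1.01) (ha : 0 ≤ a) (hab : a ≤ b)
    (hb : b ≤ 1 / 2) : GG l b ≤ GG l a := by
  have h := GG_sub l a b
  obtain ⟨h1, h2⟩ := u_bd hl hl2 ha (hab.trans hb)
  obtain ⟨h3, h4⟩ := u_bd hl hl2 (ha.trans hab) hb
  have hu : 0 ≤ l ^ 2 / (1 - b ^ 2) - l ^ 2 / (1 - a ^ 2) := by
    rw [u_sub ha hab hb]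
    have hp : 0 < 1 - a ^ 2 := by nlinarith
    have hq : 0 < 1 - b ^ 2 := by nlinarith
    have := sub_nonneg.mpr hab
    have : 0 ≤ b + a := by linarith
    positivity
  have : 0 ≤ GG l a - GG l b := by
    rw [h]
    apply mul_nonneg (by linarith)
    apply mul_nonneg hu
    linarith
  linarith

theorem GG_lip {l a b c : ℝ} (hl : 1 ≤ l) (hl2 : l ≤ 1.01) (ha : 0 ≤ a) (hab : a ≤ b)
    (hbc : b ≤ c) (hc : c ≤ 1 / 2) : GG l a - GG l b ≤ 5.6 * c * (b - a) := by
  have hb : b ≤ 1 / 2 := hbc.trans hc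
  rw [GG_sub l a b]
  obtain ⟨h1, h2⟩ := u_bd hl hl2 ha (hab.trans hb)
  obtain ⟨h3, h4⟩ := u_bd hl hl2 (ha.trans hab) hb
  have hp : 3 / 4 ≤ 1 - a ^ 2 := by nlinarith
  have hq : 3 / 4 ≤ 1 - b ^ 2 := by nlinarith
  have hpq : 9 / 16 ≤ (1 - a ^ 2) * (1 - b ^ 2) := by nlinarith
  have hba := sub_nonneg.mpr hab
  have hll : l ^ 2 ≤ 1.0201 := by norm_num at *; nlinarith
  have hm : (b - a) * (b + a) ≤ (b - a) * (2 * c) := by gcongr; linarith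
  have hd : (b - a) * (b + a) / ((1 - a ^ 2) * (1 - b ^ 2)) ≤ (b - a) * (2 * c) / (9 / 16) := by
    have : 0 ≤ c := by linarith
    gcongr
  have hd0 : 0 ≤ (b - a) * (b + a) / ((1 - a ^ 2) * (1 - b ^ 2)) := by
    have : 0 ≤ b + a := by linarith
    have : 0 < (1 - a ^ 2) * (1 - b ^ 2) := by linarith
    positivity
  rw [u_sub ha hab hb]
  have hcc : 0 ≤ c * (b - a) := mul_nonneg (by linarith) hba
  calc _ ≤ 1.01 / 2 * ((1.0201 * ((b - a) * (2 * c) / (9 / 16))) * 3) := by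
        have h5 : 5 - (l ^ 2 / (1 - a ^ 2) + l ^ 2 / (1 - b ^ 2)) ≤ 3 := by linarith
        have h50 : 0 ≤ 5 - (l ^ 2 / (1 - a ^ 2) + l ^ 2 / (1 - b ^ 2)) := by linarith
        have h51 : 0 ≤ 1.0201 * ((b - a) * (2 * c) / (9 / 16)) := by
          norm_num; nlinarith
        gcongr
    _ ≤ _ := by norm_num; nlinarith

theorem GG_le {x : ℝ} (hx0 : 0 < x) (hx1 : x < 1) (h : 1 ≤ 2 * Real.sqrt (1 - x ^ 2)) :
    GG 1 x ≤ 1 / 2 := by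
  have hp : 0 < 1 - x ^ 2 := by nlinarith
  have hs : Real.sqrt (1 - x ^ 2) ^ 2 = 1 - x ^ 2 := Real.sq_sqrt hp.le
  have h4 : 1 / 4 ≤ 1 - x ^ 2 := by nlinarith
  have h1 : 1 ≤ (1 : ℝ) ^ 2 / (1 - x ^ 2) := by rw [le_div_iff₀ hp]; nlinarith
  have h2 : (1 : ℝ) ^ 2 / (1 - x ^ 2) ≤ 4 := by rw [div_le_iff₀ hp]; nlinarith
  unfold GG
  nlinarith

theorem step_up {x y a b b' : ℝ} (h1 : y = GG 1.01 x) (h2 : x = GG 1 y) (hy : 0 ≤ y)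
    (hx : x ≤ 1 / 2) (hyb : y ≤ b) (hb : b ≤ 1 / 2) (ha : 0 ≤ a) (hab : a ≤ GG 1 b)
    (hb' : GG 1.01 a ≤ b') : y ≤ b' := by
  have h3 := GG_anti (l := 1) le_rfl (by norm_num) hy hyb hb
  have h4 := GG_anti (l := 1.01) (by norm_num) le_rfl ha (by linarith : a ≤ x) hx
  linarith

theorem step_dn {x y a b b' : ℝ} (h1 : y = GG 1.01 x) (h2 : x = GG 1 y) (hy : y ≤ 1 / 2)
    (hx : 0 ≤ x) (hyb : b ≤ y) (hb : 0 ≤ b) (ha : a ≤ 1 / 2) (hab : GG 1 b ≤ a)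
    (hb' : b' ≤ GG 1.01 a) : b' ≤ y := by
  have h3 := GG_anti (l := 1) le_rfl (by norm_num) hb hyb hy
  have h4 := GG_anti (l := 1.01) (by norm_num) le_rfl hx (by linarith : x ≤ a) ha
  linarith

theorem bounds {x y : ℝ} (h1 : y = GG 1.01 x) (h2 : x = GG 1 y) (hy : 0 ≤ y) (hx0 : 0 ≤ x)
    (hx : x ≤ 1 / 2) : (0.0271 ≤ y ∧ y ≤ 0.0277) ∧ 0.4985 ≤ x ∧ x ≤ 0.4989 := by
  have u0 : y ≤ 0.4748 := by
    have h4 := GG_anti (l := 1.01) (by norm_num) le_rfl le_rfl hx0 hx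
    have : GG 1.01 0 ≤ 0.4748 := by norm_num [GG]
    linarith
  have u1 : y ≤ 0.45760 := step_up (a := 0.10570) h1 h2 hy hx u0 (by norm_num) (by norm_num)
    (by norm_num [GG]) (by norm_num [GG])
  have u2 : y ≤ 0.44550 := step_up (a := 0.13770) h1 h2 hy hx u1 (by norm_num) (by norm_num)
    (by norm_num [GG]) (by norm_num [GG])
  have u3 : y ≤ 0.43550 := step_up (a := 0.15920) h1 h2 hy hx u2 (by norm_num) (by norm_num)
    (by norm_num [GG]) (by norm_num [GG])
  have u4 : y ≤ 0.42640 := step_up (a := 0.17630) h1 h2 hy hx u3 (by norm_num) (by norm_num)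
    (by norm_num [GG]) (by norm_num [GG])
  have u5 : y ≤ 0.41760 := step_up (a := 0.19130) h1 h2 hy hx u4 (by norm_num) (by norm_num)
    (by norm_num [GG]) (by norm_num [GG])
  have u6 : y ≤ 0.40870 := step_up (a := 0.20540) h1 h2 hy hx u5 (by norm_num) (by norm_num)
    (by norm_num [GG]) (by norm_num [GG])
  have u7 : y ≤ 0.39910 := step_up (a := 0.21930) h1 h2 hy hx u6 (by norm_num) (by norm_num)
    (by norm_num [GG]) (by norm_num [GG])
  have u8 : y ≤ 0.38850 := step_up (a := 0.23370) h1 h2 hy hx u7 (by norm_num) (by norm_num)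
    (by norm_num [GG]) (by norm_num [GG])
  have u9 : y ≤ 0.37620 := step_up (a := 0.24910) h1 h2 hy hx u8 (by norm_num) (by norm_num)
    (by norm_num [GG]) (by norm_num [GG])
  have u10 : y ≤ 0.36150 := step_up (a := 0.26630) h1 h2 hy hx u9 (by norm_num) (by norm_num)
    (by norm_num [GG]) (by norm_num [GG])
  have u11 : y ≤ 0.34330 := step_up (a := 0.28580) h1 h2 hy hx u10 (by norm_num) (by norm_num)
    (by norm_num [GG]) (by norm_num [GG])
  have u12 : y ≤ 0.32020 := step_up (a := 0.30850) h1 h2 hy hx u11 (by norm_num) (by norm_num)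
    (by norm_num [GG]) (by norm_num [GG])
  have u13 : y ≤ 0.29030 := step_up (a := 0.33510) h1 h2 hy hx u12 (by norm_num) (by norm_num)
    (by norm_num [GG]) (by norm_num [GG])
  have u14 : y ≤ 0.25140 := step_up (a := 0.36610) h1 h2 hy hx u13 (by norm_num) (by norm_num)
    (by norm_num [GG]) (by norm_num [GG])
  have u15 : y ≤ 0.20190 := step_up (a := 0.40100) h1 h2 hy hx u14 (by norm_num) (by norm_num)
    (by norm_num [GG]) (by norm_num [GG])
  have u16 : y ≤ 0.14400 := step_up (a := 0.43710) h1 h2 hy hx u15 (by norm_num) (by norm_num)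
    (by norm_num [GG]) (by norm_num [GG])
  have u17 : y ≤ 0.08780 := step_up (a := 0.46840) h1 h2 hy hx u16 (by norm_num) (by norm_num)
    (by norm_num [GG]) (by norm_num [GG])
  have u18 : y ≤ 0.04890 := step_up (a := 0.48830) h1 h2 hy hx u17 (by norm_num) (by norm_num)
    (by norm_num [GG]) (by norm_num [GG])
  have u19 : y ≤ 0.03240 := step_up (a := 0.49640) h1 h2 hy hx u18 (by norm_num) (by norm_num)
    (by norm_num [GG]) (by norm_num [GG])
  have u20 : y ≤ 0.02830 := step_up (a := 0.49840) h1 h2 hy hx u19 (by norm_num) (by norm_num)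
    (by norm_num [GG]) (by norm_num [GG])
  have u21 : y ≤ 0.02770 := step_up (a := 0.49870) h1 h2 hy hx u20 (by norm_num) (by norm_num)
    (by norm_num [GG]) (by norm_num [GG])
  have U : y ≤ 0.0277 := by linarith [u21]
  have hy2 : y ≤ 1 / 2 := by norm_num at U ⊢; linarith
  have d0 : 0 ≤ y := hy
  have d1 : 0.02489 ≤ y := step_dn (a := 0.50000) h1 h2 hy2 hx0 d0 (by norm_num) (by norm_num)
    (by norm_num [GG]) (by norm_num [GG])
  have d2 : 0.02681 ≤ y := step_dn (a := 0.49908) h1 h2 hy2 hx0 d1 (by norm_num) (by norm_num)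
    (by norm_num [GG]) (by norm_num [GG])
  have d3 : 0.02712 ≤ y := step_dn (a := 0.49893) h1 h2 hy2 hx0 d2 (by norm_num) (by norm_num)
    (by norm_num [GG]) (by norm_num [GG])
  have D : 0.0271 ≤ y := by linarith [d3]
  have a1 := GG_anti (l := 1) le_rfl (by norm_num) hy U (by norm_num)
  have a2 := GG_anti (l := 1) le_rfl (by norm_num) (by norm_num) D hy2
  have a3 : 0.4985 ≤ GG 1 0.0277 := by norm_num [GG]
  have a4 : GG 1 0.0271 ≤ 0.4989 := by norm_num [GG]
  exact ⟨⟨D, U⟩, by linarith, by linarith⟩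

theorem uniq_aux {x y x' y' : ℝ} (h1 : y = GG 1.01 x) (h2 : x = GG 1 y)
    (h1' : y' = GG 1.01 x') (h2' : x' = GG 1 y') (hy : 0 ≤ y) (hx' : 0 ≤ x')
    (hx : x ≤ 0.499) (hy' : y' ≤ 0.028) (h : y ≤ y') : x = x' ∧ y = y' := by
  have k1 := GG_lip (l := 1) le_rfl (by norm_num) hy h hy' (by norm_num)
  have hxx : x' ≤ x := by
    rw [h2, h2']
    exact GG_anti le_rfl (by norm_num) hy h (by norm_num at hy' ⊢; linarith)
  have k2 := GG_lip (l := 1.01) (by norm_num) le_rfl hx' hxx hx (by norm_num)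
  rw [← h1, ← h1'] at k2
  rw [← h2, ← h2'] at k1
  norm_num at k1 k2
  constructor <;> linarith

theorem exists_sol : ∃ x y : ℝ, y = GG 1.01 x ∧ x = GG 1 y ∧ 0.0271 ≤ y ∧ y ≤ 0.0277 ∧
    0.4985 ≤ x ∧ x ≤ 0.4989 := by
  have hg : ∀ y ∈ Set.Icc (0.0271 : ℝ) 0.0277, 0.4985 ≤ GG 1 y ∧ GG 1 y ≤ 0.4989 := by
    rintro y ⟨D, U⟩
    have hy : 0 ≤ y := le_trans (by norm_num) D
    have hy2 : y ≤ 1 / 2 := le_trans U (by norm_num)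
    have a1 := GG_anti (l := 1) le_rfl (by norm_num) hy U (by norm_num)
    have a2 := GG_anti (l := 1) le_rfl (by norm_num) (by norm_num) D hy2
    have a3 : 0.4985 ≤ GG 1 0.0277 := by norm_num [GG]
    have a4 : GG 1 0.0271 ≤ 0.4989 := by norm_num [GG]
    exact ⟨by linarith, by linarith⟩
  have hcont : ∀ l : ℝ, ContinuousOn (GG l) (Set.Icc 0 (1 / 2)) := by
    intro l
    unfold GG
    have : ∀ x ∈ Set.Icc (0 : ℝ) (1 / 2), 1 - x ^ 2 ≠ 0 := by
      rintro x ⟨h0, h1⟩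
      nlinarith
    fun_prop (disch := assumption)
  have hc : ContinuousOn (fun y => GG 1.01 (GG 1 y) - y) (Set.Icc (0.0271 : ℝ) 0.0277) := by
    refine ContinuousOn.sub ?_ continuousOn_id
    refine (hcont 1.01).comp ((hcont 1).mono ?_) ?_
    · exact Set.Icc_subset_Icc (by norm_num) (by norm_num)
    · intro y hy
      obtain ⟨h0, h1⟩ := hg y hy
      exact ⟨le_trans (by norm_num) h0, le_trans h1 (by norm_num)⟩
  have hI := intermediate_value_Icc' (by norm_num) hc
  have h0 : (0 : ℝ) ∈ Set.Icc (GG 1.01 (GG 1 0.0277) - 0.0277) (GG 1.01 (GG 1 0.0271) - 0.0271) := by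
    constructor <;> norm_num [GG]
  obtain ⟨y, hy, he⟩ := hI h0
  obtain ⟨g0, g1⟩ := hg y hy
  exact ⟨GG 1 y, y, by simp only at he; linarith, rfl, hy.1, hy.2, g0, g1⟩

theorem sqrt_bd {l x : ℝ} (hl : 0 ≤ l) (hl2 : l ≤ 1.01) (hx : 0 ≤ x) (hx2 : x ≤ 1 / 2) :
    l ≤ 2 * Real.sqrt (1 - x ^ 2) := by
  have : l / 2 ≤ Real.sqrt (1 - x ^ 2) := by
    apply Real.le_sqrt_of_sq_le
    norm_num at hl2
    nlinarith
  linarith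

/-- For `l = 1.01`, `l̃ = 1` there is a unique pentagonal Siamese dipyramid,
whose heights satisfy `0.498 < x < 0.499` and `0.027 < x̃ < 0.028`. -/
theorem siamese_unique_solution_101 :
    ∃ p : ℝ × ℝ, {q : ℝ × ℝ | SiamesePosSol5 1.01 1 q} = {p} ∧
      0.498 < p.1 ∧ p.1 < 0.499 ∧ 0.027 < p.2 ∧ p.2 < 0.028 := by
  obtain ⟨x, y, h1, h2, b1, b2, b3, b4⟩ := exists_sol
  refine ⟨(x, y), ?_, lt_of_lt_of_le (by norm_num) b3, lt_of_le_of_lt b4 (by norm_num),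
    lt_of_lt_of_le (by norm_num) b1, lt_of_le_of_lt b2 (by norm_num)⟩
  have x0 : 0 < x := lt_of_lt_of_le (by norm_num) b3
  have y0 : 0 < y := lt_of_lt_of_le (by norm_num) b1
  have x2 : x ≤ 1 / 2 := b4.trans (by norm_num)
  have y2 : y ≤ 1 / 2 := b2.trans (by norm_num)
  have x499 : x ≤ 0.499 := b4.trans (by norm_num)
  have y028 : y ≤ 0.028 := b2.trans (by norm_num)
  ext ⟨x', y'⟩
  simp only [Set.mem_ofPred_eq, Set.mem_singleton_iff, SiamesePosSol5, Prod.mk.injEq]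
  constructor
  · rintro ⟨p1, p2, p3, p4, p5, p6, p7, p8⟩
    rw [key (by norm_num) p1 p2 p5] at p7
    rw [key (by norm_num) p3 p4 p6] at p8
    have hx' : x' ≤ 1 / 2 := p8 ▸ GG_le p3 p4 p6
    obtain ⟨⟨c1, c2⟩, c3, c4⟩ := bounds p7 p8 p3.le p1.le hx'
    rcases le_total y y' with h | h
    · obtain ⟨e1, e2⟩ := uniq_aux h1 h2 p7 p8 y0.le p1.le x499 (c2.trans (by norm_num)) h
      exact ⟨e1.symm, e2.symm⟩
    · exact uniq_aux p7 p8 h1 h2 p3.le x0.le (c4.trans (by norm_num)) y028 h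
  · rintro ⟨rfl, rfl⟩
    have s1 := sqrt_bd (l := 1.01) (by norm_num) le_rfl x0.le x2
    have s2 := sqrt_bd (l := 1) (by norm_num) (by norm_num) y0.le y2
    have x1 : x' < 1 := by linarith
    have y1 : y' < 1 := by linarith
    refine ⟨x0, x1, y0, y1, s1, s2, ?_, ?_⟩
    · rw [key (by norm_num) x0 x1 s1]; exact h1
    · rw [key (by norm_num) y0 y1 s2]; exact h2
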